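/- Let K be a field with char K ≠ 2. Then ed_K(A₃) = 1, ed_K(A₄) = ed_K(A₅) = 2, ed_K(A_{n+4}) ≥ ed_K(A_n) + 2 for every integer n ≥ 4, and ed_K(A_n) ≥ 2·⌊n/4⌋ for every integer n ≥ 3. -/

import Mathlib

noncomputable section

/-- The transcendence degree of `L` over `K`: the supremum of the cardinalities of
algebraically independent subsets of `L`. -/
noncomputable def trdeg (K L : Type*) [CommRing K] [CommRing L] [Algebra K L] : Cardinal :=
  ⨆ s : {s : Set L // AlgebraicIndependent K ((↑) : s → L)}, Cardinal.mk s.1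

/-- The rational function field over `K` on variables indexed by `σ` :
the fraction field of the polynomial ring `K[x_i : i ∈ σ]`. -/
abbrev FnField (K : Type*) [Field K] (σ : Type*) : Type _ :=
  FractionRing (MvPolynomial σ K)

/-- Permutations of the variables acting on the polynomial ring by `K`-algebra
automorphisms. -/
noncomputable def permHom (K : Type*) [Field K] (σ : Type*) :
    Equiv.Perm σ →* (MvPolynomial σ K ≃ₐ[K] MvPolynomial σ K) where
  toFun e := MvPolynomial.renameEquiv K e
  map_one' := MvPolynomial.renameEquiv_refl K
  map_mul' e f := by
    ext x
    simp [MvPolynomial.renameEquiv, Equiv.Perm.mul_apply]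

/-- Permutations of the variables acting on the rational function field by
`K`-algebra automorphisms. -/
noncomputable def permGalAction (K : Type*) [Field K] (σ : Type*) :
    Equiv.Perm σ →* (FnField K σ ≃ₐ[K] FnField K σ) :=
  (IsFractionRing.fieldEquivOfAlgEquivHom K (FnField K σ)).comp (permHom K σ)

/-- The action of a group `G` on its rational function field `K(x_g : g ∈ G)` by
`K`-algebra automorphisms, permuting the variables by left translation:
`σ • x_g = x_{σg}`. -/
noncomputable def galAction (K : Type*) [Field K] (G : Type*) [Group G] :
    G →* (FnField K G ≃ₐ[K] FnField K G) :=
  (permGalAction K G).comp (MulAction.toPermHom G G)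

/-- The essential dimension of a group `G` over the field `K`:
the minimum of the transcendence degrees over `K` of the `G`-stable intermediate
subfields of the rational function field `K(x_g : g ∈ G)` on which `G` acts
faithfully. -/
noncomputable def edK (K : Type*) [Field K] (G : Type*) [Group G] : ℕ :=
  sInf { d : ℕ | ∃ E : IntermediateField K (FnField K G),
    (∀ g : G, ∀ x ∈ E, galAction K G g x ∈ E) ∧
    (∀ g : G, g ≠ 1 → ∃ x ∈ E, galAction K G g x ≠ x) ∧
    trdeg K E = d }

section HahnIndependence

open HahnSeries

variable {K F Γ : Type*} [Field K] [Field F] [Algebra K F] [AddCommGroup Γ] [LinearOrder Γ]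
  [IsOrderedAddMonoid Γ]

omit [IsOrderedAddMonoid Γ] in
theorem hahn_order_add_of_lt {x y : HahnSeries Γ F} (hx : x ≠ 0) (hy : y ≠ 0)
    (h : x.order < y.order) : x + y ≠ 0 ∧ (x + y).order = x.order := by
  have hlt : x.orderTop < y.orderTop := by
    rw [← order_eq_orderTop_of_ne_zero hx, ← order_eq_orderTop_of_ne_zero hy]
    exact_mod_cast h
  have h1 := orderTop_add_eq_left hlt
  have hne : x + y ≠ 0 := by
    intro h0
    rw [h0, orderTop_zero] at h1
    exact (h1 ▸ hlt).not_ge le_top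
  refine ⟨hne, ?_⟩
  rw [← order_eq_orderTop_of_ne_zero hx, ← order_eq_orderTop_of_ne_zero hne] at h1
  exact_mod_cast h1

omit [IsOrderedAddMonoid Γ] in
theorem hahn_order_add_of_ne {x y : HahnSeries Γ F} (hx : x ≠ 0) (hy : y ≠ 0)
    (h : x.order ≠ y.order) :
    x + y ≠ 0 ∧ ((x + y).order = x.order ∨ (x + y).order = y.order) := by
  rcases lt_or_gt_of_ne h with h | h
  · exact ⟨(hahn_order_add_of_lt hx hy h).1, .inl (hahn_order_add_of_lt hx hy h).2⟩
  · rw [add_comm]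
    exact ⟨(hahn_order_add_of_lt hy hx h).1, .inr (hahn_order_add_of_lt hy hx h).2⟩

/-- Evaluating a polynomial at an element whose order is independent of the orders of the
coefficients: no cancellation of leading terms can happen. -/
theorem hahn_order_aeval (A : Subalgebra K (HahnSeries Γ F)) (D : AddSubgroup Γ)
    (hA : ∀ p ∈ A, p ≠ 0 → p.order ∈ D) {x : HahnSeries Γ F} (hx : x ≠ 0)
    (hxD : ∀ n : ℤ, n • x.order ∈ D → n = 0) (q : Polynomial A) (hq : q ≠ 0) :
    Polynomial.aeval x q ≠ 0 ∧
      ∃ n ≤ q.natDegree, ∃ d ∈ D, (Polynomial.aeval x q).order = d + n • x.order := by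
  have key : ∀ (n : ℕ) (a : A), a ≠ 0 → (a : HahnSeries Γ F) * x ^ n ≠ 0 ∧
      ∃ d ∈ D, ((a : HahnSeries Γ F) * x ^ n).order = d + n • x.order := by
    intro n a ha
    have ha' : (a : HahnSeries Γ F) ≠ 0 := by simpa using ha
    refine ⟨mul_ne_zero ha' (pow_ne_zero _ hx), _, hA a a.2 ha', ?_⟩
    rw [order_mul ha' (pow_ne_zero _ hx), order_pow]
  induction h : q.support.card using Nat.strong_induction_on generalizing q with
  | _ m ih =>
    have hlc : q.leadingCoeff ≠ 0 := by simpa using hq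
    have hsum : Polynomial.aeval x q = Polynomial.aeval x q.eraseLead +
        (q.leadingCoeff : HahnSeries Γ F) * x ^ q.natDegree := by
      conv_lhs => rw [← q.eraseLead_add_monomial_natDegree_leadingCoeff]
      rw [map_add, Polynomial.aeval_monomial]
      rfl
    obtain ⟨h1, d, hd, h2⟩ := key q.natDegree _ hlc
    by_cases h0 : q.eraseLead = 0
    · rw [hsum, h0, map_zero, zero_add]
      exact ⟨h1, _, le_rfl, d, hd, h2⟩
    · have hdeg := Polynomial.eraseLead_natDegree_lt_or_eraseLead_eq_zero q
      obtain ⟨h3, n, hn, d', hd', h4⟩ := ih _ (h ▸ Polynomial.eraseLead_support_card_lt hq)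
        q.eraseLead h0 rfl
      have hlt : n < q.natDegree := lt_of_le_of_lt hn (hdeg.resolve_right h0)
      have hne : (Polynomial.aeval x q.eraseLead).order ≠
          ((q.leadingCoeff : HahnSeries Γ F) * x ^ q.natDegree).order := by
        rw [h2, h4]
        intro he
        have : ((q.natDegree : ℤ) - n) • x.order ∈ D := by
          have : ((q.natDegree : ℤ) - n) • x.order = d' - d := by
            rw [sub_zsmul, natCast_zsmul, natCast_zsmul, ← sub_eq_add_neg,
              sub_eq_sub_iff_add_eq_add, add_comm, ← he]
          rw [this]
          exact D.sub_mem hd' hd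
        have := hxD _ this
        omega
      obtain ⟨h5, h6⟩ := hahn_order_add_of_ne h3 h1 hne
      rw [hsum]
      refine ⟨h5, ?_⟩
      rcases h6 with h6 | h6
      · exact ⟨n, hlt.le, d', hd', h6.trans h4⟩
      · exact ⟨_, le_rfl, d, hd, h6.trans h2⟩

theorem hahn_option_algebraicIndependent {ι : Type*} {u : ι → HahnSeries Γ F}
    (hu : AlgebraicIndependent K u) (D : AddSubgroup Γ)
    (hA : ∀ p ∈ Algebra.adjoin K (Set.range u), p ≠ 0 → p.order ∈ D)
    {x : HahnSeries Γ F} (hx : x ≠ 0) (hxD : ∀ n : ℤ, n • x.order ∈ D → n = 0) :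
    AlgebraicIndependent K (fun o : Option ι ↦ o.elim x u) ∧
      ∀ p ∈ Algebra.adjoin K (Set.range (fun o : Option ι ↦ o.elim x u)), p ≠ 0 →
        p.order ∈ D ⊔ AddSubgroup.zmultiples x.order := by
  refine ⟨(hu.option_iff_transcendental x).2 ?_, ?_⟩
  · rw [transcendental_iff]
    intro q hq
    by_contra hq0
    exact (hahn_order_aeval _ D hA hx hxD q hq0).1 hq
  · intro p hp hp0
    have hle : Algebra.adjoin K (Set.range (fun o : Option ι ↦ o.elim x u)) ≤
        (Polynomial.aeval x : Polynomial (Algebra.adjoin K (Set.range u)) →ₐ[_] _).range.restrictScalars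
          K := by
      rw [Algebra.adjoin_le_iff]
      rintro _ ⟨_ | i, rfl⟩
      · exact ⟨Polynomial.X, by simp⟩
      · exact ⟨Polynomial.C ⟨u i, Algebra.subset_adjoin ⟨i, rfl⟩⟩, by simp⟩
    obtain ⟨q, rfl⟩ := hle hp
    have hq : q ≠ 0 := by
      rintro rfl
      simp at hp0
    obtain ⟨-, n, -, d, hd, h⟩ := hahn_order_aeval _ D hA hx hxD q hq
    change (Polynomial.aeval x q).order ∈ _
    rw [h]
    exact add_mem (AddSubgroup.mem_sup_left hd)
      (AddSubgroup.mem_sup_right (nsmul_mem (AddSubgroup.mem_zmultiples _) n))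

theorem hahn_coeff_zero_mul {x y : HahnSeries Γ F} (hx : 0 ≤ x.orderTop) (hy : 0 ≤ y.orderTop) :
    (x * y).coeff 0 = x.coeff 0 * y.coeff 0 := by
  rcases hx.lt_or_eq with hx' | hx'
  · rw [coeff_eq_zero_of_lt_orderTop (x := x) (by exact_mod_cast hx'), zero_mul]
    apply coeff_eq_zero_of_lt_orderTop
    rw [orderTop_mul]
    exact lt_of_lt_of_le hx' (le_add_of_nonneg_right hy)
  rcases hy.lt_or_eq with hy' | hy'
  · rw [coeff_eq_zero_of_lt_orderTop (x := y) (by exact_mod_cast hy'), mul_zero]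
    apply coeff_eq_zero_of_lt_orderTop
    rw [orderTop_mul]
    exact lt_of_lt_of_le hy' (le_add_of_nonneg_left hx)
  have h0 : ∀ z : HahnSeries Γ F, 0 = z.orderTop → z.order = 0 := by
    intro z hz
    have hz0 : z ≠ 0 := by
      rintro rfl
      simp at hz
    rw [← order_eq_orderTop_of_ne_zero hz0] at hz
    exact_mod_cast hz.symm
  have := coeff_mul_order_add_order x y
  rw [leadingCoeff_eq, leadingCoeff_eq, h0 x hx', h0 y hy', add_zero] at this
  exact this

theorem hahn_aeval_coeff_zero {ι : Type*} {u : ι → HahnSeries Γ F}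
    (hu : ∀ i, 0 ≤ (u i).orderTop) (P : MvPolynomial ι K) :
    0 ≤ (MvPolynomial.aeval u P).orderTop ∧
      (MvPolynomial.aeval u P).coeff 0 = MvPolynomial.aeval (fun i ↦ (u i).coeff 0) P := by
  induction P using MvPolynomial.induction_on with
  | C a =>
    rw [MvPolynomial.aeval_C, MvPolynomial.aeval_C, HahnSeries.algebraMap_apply]
    exact ⟨zero_le_orderTop_iff.2 order_C.ge, by simp⟩
  | add p q hp hq =>
    rw [map_add, map_add]
    exact ⟨(le_min hp.1 hq.1).trans min_orderTop_le_orderTop_add,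
      by rw [coeff_add, hp.2, hq.2]⟩
  | mul_X p i hp =>
    rw [map_mul, map_mul, MvPolynomial.aeval_X, MvPolynomial.aeval_X]
    refine ⟨?_, by rw [hahn_coeff_zero_mul hp.1 (hu i), hp.2]⟩
    rw [orderTop_mul]
    exact add_nonneg hp.1 (hu i)

/-- Units with algebraically independent residues are algebraically independent, and
nonzero polynomials in them are again units. -/
theorem hahn_algebraicIndependent_of_residue {ι : Type*} {u : ι → HahnSeries Γ F}
    (hu : ∀ i, (u i).order = 0)
    (hlc : AlgebraicIndependent K (fun i ↦ (u i).leadingCoeff)) :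
    AlgebraicIndependent K u ∧
      ∀ p ∈ Algebra.adjoin K (Set.range u), p ≠ 0 → p.order ∈ (⊥ : AddSubgroup Γ) := by
  have hu' : ∀ i, 0 ≤ (u i).orderTop := fun i ↦ zero_le_orderTop_iff.2 (hu i).ge
  have hc : (fun i ↦ (u i).coeff 0) = fun i ↦ (u i).leadingCoeff := by
    funext i
    rw [leadingCoeff_eq, hu i]
  have key : ∀ P : MvPolynomial ι K, P ≠ 0 → (MvPolynomial.aeval u P).coeff 0 ≠ 0 := by
    intro P hP h
    rw [(hahn_aeval_coeff_zero hu' P).2, hc] at h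
    exact hP ((injective_iff_map_eq_zero _).1 hlc P h)
  refine ⟨(injective_iff_map_eq_zero _).2 fun P hP ↦ ?_, fun p hp hp0 ↦ ?_⟩
  · by_contra h0
    exact key P h0 (by rw [hP]; simp)
  · rw [Algebra.adjoin_range_eq_range_aeval] at hp
    obtain ⟨P, rfl⟩ := hp
    have hP : P ≠ 0 := by
      rintro rfl
      simp at hp0
    exact le_antisymm (order_le_of_coeff_ne_zero (key P hP))
      (zero_le_orderTop_iff.1 (hahn_aeval_coeff_zero hu' P).1)

/-- Units with algebraically independent residues, together with two elements whose orders are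
linearly independent over `ℤ`, are algebraically independent. -/
theorem hahn_option_option_algebraicIndependent {ι : Type*} {u : ι → HahnSeries Γ F}
    (hu : ∀ i, (u i).order = 0)
    (hlc : AlgebraicIndependent K (fun i ↦ (u i).leadingCoeff))
    {x y : HahnSeries Γ F} (hx : x ≠ 0) (hy : y ≠ 0)
    (hxy : ∀ m n : ℤ, m • x.order + n • y.order = 0 → m = 0 ∧ n = 0) :
    AlgebraicIndependent K
      (fun o : Option (Option ι) ↦ o.elim y (fun o : Option ι ↦ o.elim x u)) := by
  obtain ⟨h1, h2⟩ := hahn_algebraicIndependent_of_residue hu hlc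
  obtain ⟨h3, h4⟩ := hahn_option_algebraicIndependent h1 ⊥ h2 hx fun n hn ↦
    (hxy n 0 (by simpa using hn)).1
  refine (hahn_option_algebraicIndependent h3 _ h4 hy fun n hn ↦ ?_).1
  rw [bot_sup_eq] at hn
  obtain ⟨m, hm⟩ := AddSubgroup.mem_zmultiples_iff.1 hn
  exact (hxy (-m) n (by rw [← hm]; simp)).2

end HahnIndependence

section HahnResidue

open HahnSeries

variable {K F M Γ : Type*} [Field K] [Field F] [Algebra K F] [Field M] [Algebra K M]
  [AddCommGroup Γ] [LinearOrder Γ] [IsOrderedAddMonoid Γ]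

theorem hahn_order_div {x y : HahnSeries Γ F} (hx : x ≠ 0) (hy : y ≠ 0) :
    (x / y).order = x.order - y.order := by
  rw [eq_sub_iff_add_eq, ← order_mul (div_ne_zero hx hy) hy, div_mul_cancel₀ _ hy]

theorem hahn_leadingCoeff_div {x y : HahnSeries Γ F} (hy : y ≠ 0) :
    (x / y).leadingCoeff = x.leadingCoeff / y.leadingCoeff := by
  rw [eq_div_iff (leadingCoeff_ne_zero.2 hy), ← leadingCoeff_mul, div_mul_cancel₀ _ hy]

omit [IsOrderedAddMonoid Γ] in
theorem hahn_order_eq_zero_of_coeff_zero_ne {x : HahnSeries Γ F} (hx : 0 ≤ x.orderTop)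
    (h : x.coeff 0 ≠ 0) : x ≠ 0 ∧ x.order = 0 ∧ x.leadingCoeff = x.coeff 0 := by
  have h0 : x.order = 0 :=
    le_antisymm (order_le_of_coeff_ne_zero h) (zero_le_orderTop_iff.1 hx)
  refine ⟨by rintro rfl; simp at h, h0, by rw [leadingCoeff_eq, h0]⟩

/-- The residue field of a subfield `E` of `M` for the valuation on `M` induced by an
embedding of `M` into a field of Hahn series. -/
def hahnResidueField (j : M →ₐ[K] HahnSeries Γ F) (E : IntermediateField K M) :
    IntermediateField K F where
  carrier := {a | ∃ x ∈ E, 0 ≤ (j x).orderTop ∧ (j x).coeff 0 = a}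
  mul_mem' := by
    rintro _ _ ⟨x, hx, hx0, rfl⟩ ⟨y, hy, hy0, rfl⟩
    refine ⟨x * y, mul_mem hx hy, ?_, by rw [map_mul, hahn_coeff_zero_mul hx0 hy0]⟩
    rw [map_mul, orderTop_mul]
    exact add_nonneg hx0 hy0
  add_mem' := by
    rintro _ _ ⟨x, hx, hx0, rfl⟩ ⟨y, hy, hy0, rfl⟩
    refine ⟨x + y, add_mem hx hy, ?_, by rw [map_add, coeff_add]⟩
    rw [map_add]
    exact (le_min hx0 hy0).trans min_orderTop_le_orderTop_add
  algebraMap_mem' r := by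
    refine ⟨algebraMap K M r, E.algebraMap_mem r, ?_, ?_⟩
    · rw [AlgHom.commutes, HahnSeries.algebraMap_apply]
      exact zero_le_orderTop_iff.2 order_C.ge
    · rw [AlgHom.commutes, HahnSeries.algebraMap_apply]
      simp
  inv_mem' := by
    rintro _ ⟨x, hx, hx0, rfl⟩
    by_cases h : (j x).coeff 0 = 0
    · exact ⟨0, E.zero_mem, by simp, by simp [h]⟩
    · obtain ⟨h1, h2, h3⟩ := hahn_order_eq_zero_of_coeff_zero_ne hx0 h
      have h4 : (j x⁻¹).order = 0 := by
        rw [map_inv₀, ← one_div, hahn_order_div one_ne_zero h1, h2, order_one, sub_zero]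
      refine ⟨x⁻¹, inv_mem hx, zero_le_orderTop_iff.2 h4.ge, ?_⟩
      have h5 : (j x⁻¹).leadingCoeff = ((j x).coeff 0)⁻¹ := by
        rw [map_inv₀, ← one_div, hahn_leadingCoeff_div h1, leadingCoeff_one, h3, one_div]
      rw [← h5, leadingCoeff_eq, h4]

theorem mem_hahnResidueField_of_ne_zero {j : M →ₐ[K] HahnSeries Γ F} {E : IntermediateField K M}
    {a : F} (ha : a ≠ 0) : a ∈ hahnResidueField j E ↔
      ∃ x ∈ E, x ≠ 0 ∧ (j x).order = 0 ∧ (j x).leadingCoeff = a := by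
  constructor
  · rintro ⟨x, hx, hx0, rfl⟩
    obtain ⟨h1, h2, h3⟩ := hahn_order_eq_zero_of_coeff_zero_ne hx0 ha
    exact ⟨x, hx, by rintro rfl; simp at h1, h2, h3⟩
  · rintro ⟨x, hx, -, h0, rfl⟩
    exact ⟨x, hx, zero_le_orderTop_iff.2 h0.ge, by rw [leadingCoeff_eq, h0]⟩

theorem div_mem_hahnResidueField (j : M →ₐ[K] HahnSeries Γ F) {E : IntermediateField K M}
    {x y : M} (hx : x ∈ E) (hy : y ∈ E) (hx0 : x ≠ 0) (hy0 : y ≠ 0)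
    (h : (j x).order = (j y).order) :
    (j x).leadingCoeff / (j y).leadingCoeff ∈ hahnResidueField j E := by
  have hjx : j x ≠ 0 := by simpa using hx0
  have hjy : j y ≠ 0 := by simpa using hy0
  refine (mem_hahnResidueField_of_ne_zero
    (div_ne_zero (leadingCoeff_ne_zero.2 hjx) (leadingCoeff_ne_zero.2 hjy))).2
    ⟨x / y, div_mem hx hy, div_ne_zero hx0 hy0, ?_, ?_⟩
  · rw [map_div₀, hahn_order_div hjx hjy, h, sub_self]
  · rw [map_div₀, hahn_leadingCoeff_div hjy]

end HahnResidue

theorem trdeg_eq_algebraTrdeg (K L : Type*) [CommRing K] [CommRing L] [Algebra K L] :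
    trdeg K L = Algebra.trdeg K L := rfl

section Trdeg

open HahnSeries

universe u

variable {K F M : Type u} {Γ : Type*} [Field K] [Field F] [Algebra K F] [Field M] [Algebra K M]
  [AddCommGroup Γ] [LinearOrder Γ] [IsOrderedAddMonoid Γ]

/-- Abhyankar's inequality in rational rank two. -/
theorem trdeg_hahnResidueField_add_two_le (j : M →ₐ[K] HahnSeries Γ F)
    (E : IntermediateField K M) {x y : M} (hx : x ∈ E) (hy : y ∈ E) (hx0 : x ≠ 0) (hy0 : y ≠ 0)
    (hxy : ∀ m n : ℤ, m • (j x).order + n • (j y).order = 0 → m = 0 ∧ n = 0) :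
    trdeg K (hahnResidueField j E) + 2 ≤ trdeg K E := by
  rw [trdeg_eq_algebraTrdeg, trdeg_eq_algebraTrdeg]
  obtain ⟨s, hs⟩ := exists_isTranscendenceBasis K (hahnResidueField j E)
  rw [← hs.cardinalMk_eq_trdeg]
  have hne : ∀ i : s, ((i : hahnResidueField j E) : F) ≠ 0 := fun i ↦ by
    have := hs.1.ne_zero i
    simpa using this
  choose z hzE hz0 hzord hzlc using fun i : s ↦
    (mem_hahnResidueField_of_ne_zero (hne i)).1 (i : hahnResidueField j E).2
  have hF : AlgebraicIndependent K (fun i : s ↦ (j (z i)).leadingCoeff) := by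
    simp_rw [hzlc]
    exact hs.1.map' (f := (hahnResidueField j E).val) Subtype.val_injective
  have hL := hahn_option_option_algebraicIndependent (u := fun i ↦ j (z i)) hzord hF
    (by simpa using hx0) (by simpa using hy0) hxy
  have hE : AlgebraicIndependent K (fun o : Option (Option s) ↦
      o.elim (⟨y, hy⟩ : E) (fun o : Option s ↦ o.elim ⟨x, hx⟩ fun i ↦ ⟨z i, hzE i⟩)) := by
    apply AlgebraicIndependent.of_comp (j.comp E.val)
    convert! hL using 1
    funext o
    rcases o with _ | _ | i <;> rfl
  have := hE.cardinalMk_le_trdeg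
  rwa [Cardinal.mk_option, Cardinal.mk_option, add_assoc, one_add_one_eq_two] at this

end Trdeg

section Eigenvectors

variable {K M : Type*} [Field K] [Field M] [Algebra K M]

theorem exists_neg_eigenvector (E : IntermediateField K M) {a : M ≃ₐ[K] M}
    (haE : ∀ x ∈ E, a x ∈ E) (ha : ∀ x, a (a x) = x) (hne : ∃ x ∈ E, a x ≠ x) :
    ∃ x ∈ E, x ≠ 0 ∧ a x = -x := by
  obtain ⟨x, hx, hax⟩ := hne
  exact ⟨x - a x, sub_mem hx (haE x hx), sub_ne_zero.2 hax.symm, by rw [map_sub, ha, neg_sub]⟩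

theorem exists_neg_joint_eigenvector (E : IntermediateField K M) {a b : M ≃ₐ[K] M}
    (haE : ∀ x ∈ E, a x ∈ E) (hbE : ∀ x ∈ E, b x ∈ E)
    (ha : ∀ x, a (a x) = x) (hb : ∀ x, b (b x) = x) (hab : ∀ x, a (b x) = b (a x))
    (hne : ∃ x ∈ E, a x ≠ x) :
    (∃ x ∈ E, x ≠ 0 ∧ a x = -x ∧ b x = x) ∨ (∃ x ∈ E, x ≠ 0 ∧ a x = -x ∧ b x = -x) := by
  obtain ⟨x, hx, hx0, hax⟩ := exists_neg_eigenvector E haE ha hne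
  by_cases h : x + b x = 0
  · exact .inr ⟨x, hx, hx0, hax, by rw [eq_neg_iff_add_eq_zero, add_comm, h]⟩
  · refine .inl ⟨x + b x, add_mem hx (hbE x hx), h, ?_, ?_⟩
    · rw [map_add, hab, hax, map_neg]
      ring
    · rw [map_add, hb, add_comm]

/-- A field with a faithful action of the Klein four-group contains eigenvectors for
two given independent characters. -/
theorem exists_dual_eigenvectors (E : IntermediateField K M) {a b : M ≃ₐ[K] M}
    (haE : ∀ x ∈ E, a x ∈ E) (hbE : ∀ x ∈ E, b x ∈ E)
    (ha : ∀ x, a (a x) = x) (hb : ∀ x, b (b x) = x) (hab : ∀ x, a (b x) = b (a x))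
    (hane : ∃ x ∈ E, a x ≠ x) (hbne : ∃ x ∈ E, b x ≠ x) (habne : ∃ x ∈ E, a (b x) ≠ x) :
    (∃ x ∈ E, x ≠ 0 ∧ a x = -x ∧ b x = x) ∧ (∃ y ∈ E, y ≠ 0 ∧ a y = y ∧ b y = -y) := by
  have h1 := exists_neg_joint_eigenvector E haE hbE ha hb hab hane
  have h2 := exists_neg_joint_eigenvector E hbE haE hb ha (fun x ↦ (hab x).symm) hbne
  have h3 := exists_neg_joint_eigenvector E (a := a * b) (b := a)
    (fun x hx ↦ haE _ (hbE x hx)) haE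
    (fun x ↦ by rw [AlgEquiv.mul_apply, AlgEquiv.mul_apply, ← hab, hb, ha]) ha
    (fun x ↦ by rw [AlgEquiv.mul_apply, AlgEquiv.mul_apply, ← hab]) habne
  simp only [AlgEquiv.mul_apply] at h3
  have h4 : (∃ x ∈ E, x ≠ 0 ∧ a x = -x ∧ b x = x) ∨ (∃ y ∈ E, y ≠ 0 ∧ a y = y ∧ b y = -y) := by
    rcases h3 with ⟨x, hx, hx0, h, h'⟩ | ⟨x, hx, hx0, h, h'⟩
    · refine .inr ⟨x, hx, hx0, h', ?_⟩
      rw [hab, h'] at h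
      exact h
    · refine .inl ⟨x, hx, hx0, h', ?_⟩
      rw [hab, h', map_neg, neg_inj] at h
      exact h
  rcases h1 with h1 | ⟨z, hz, hz0, haz, hbz⟩
  · rcases h2 with ⟨y, hy, hy0, hby, hay⟩ | ⟨z, hz, hz0, hbz, haz⟩
    · exact ⟨h1, y, hy, hy0, hay, hby⟩
    · obtain ⟨x, hx, hx0, hax, hbx⟩ := h1
      exact ⟨⟨x, hx, hx0, hax, hbx⟩, x * z, mul_mem hx hz, mul_ne_zero hx0 hz0,
        by rw [map_mul, hax, haz, neg_mul_neg], by rw [map_mul, hbx, hbz, mul_neg]⟩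
  · rcases h4 with ⟨x, hx, hx0, hax, hbx⟩ | ⟨x, hx, hx0, hax, hbx⟩
    · exact ⟨⟨x, hx, hx0, hax, hbx⟩, x * z, mul_mem hx hz, mul_ne_zero hx0 hz0,
        by rw [map_mul, hax, haz, neg_mul_neg], by rw [map_mul, hbx, hbz, mul_neg]⟩
    · exact ⟨⟨x * z, mul_mem hx hz, mul_ne_zero hx0 hz0,
        by rw [map_mul, hax, haz, mul_neg], by rw [map_mul, hbx, hbz, neg_mul_neg]⟩,
        x, hx, hx0, hax, hbx⟩

end Eigenvectors

/-- Two elements of a torsion-free abelian group separated by a pair of quadratic characters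
are linearly independent over `ℤ`. -/
theorem zsmul_independent_of_sign_characters {Γ : Type*} [AddCommGroup Γ]
    [IsAddTorsionFree Γ] {χ ψ : Multiplicative Γ →* ℤˣ} {a b : Γ}
    (hχa : χ (.ofAdd a) = -1) (hχb : χ (.ofAdd b) = 1)
    (hψa : ψ (.ofAdd a) = 1) (hψb : ψ (.ofAdd b) = -1)
    (m n : ℤ) (h : m • a + n • b = 0) : m = 0 ∧ n = 0 := by
  induction hk : m.natAbs + n.natAbs using Nat.strong_induction_on generalizing m n with
  | _ k ih =>
    have heven : ∀ i : ℤ, (-1 : ℤˣ) ^ i = 1 → Even i := by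
      intro i hi
      by_contra hodd
      rw [Int.not_even_iff_odd] at hodd
      rw [hodd.neg_one_zpow] at hi
      exact absurd hi (by decide)
    have hm : Even m := by
      have := congrArg (fun c ↦ χ (.ofAdd c)) h
      simp only [ofAdd_add, ofAdd_zsmul, map_mul, map_zpow, hχa, hχb, one_zpow, mul_one,
        ofAdd_zero, map_one] at this
      exact heven m this
    have hn : Even n := by
      have := congrArg (fun c ↦ ψ (.ofAdd c)) h
      simp only [ofAdd_add, ofAdd_zsmul, map_mul, map_zpow, hψa, hψb, one_zpow, one_mul,
        ofAdd_zero, map_one] at this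
      exact heven n this
    obtain ⟨m, rfl⟩ := hm
    obtain ⟨n, rfl⟩ := hn
    by_cases h0 : m = 0 ∧ n = 0
    · simp [h0.1, h0.2]
    have h2 : m • a + n • b = 0 := by
      have : (2 : ℕ) • (m • a + n • b) = 0 := by
        rw [← h, two_nsmul, add_zsmul, add_zsmul]
        abel
      exact (smul_eq_zero_iff_right (by norm_num)).1 this
    have := ih _ (by omega) m n h2 rfl
    omega

section ResidueAction

open HahnSeries

universe u

variable {K F M : Type u} {G Γ : Type*} [Field K] [Field F] [Algebra K F] [Field M] [Algebra K M]
  [AddCommGroup Γ] [LinearOrder Γ] [IsOrderedAddMonoid Γ] [Group G]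

/-- Every nontrivial normal subgroup contains an involution whose commutator with some
group element is again an involution. -/
def HasInvolutionCommutators (G : Type*) [Group G] : Prop :=
  ∀ N : Subgroup G, N.Normal → N ≠ ⊥ → ∃ s ∈ N, ∃ g : G, s * s = 1 ∧
    g * s * g⁻¹ * s ≠ 1 ∧ (g * s * g⁻¹ * s) * (g * s * g⁻¹ * s) = 1

/-- Passing to the residue field: a faithful `G × (ℤ/2)²`-subfield of transcendence degree `d`
gives a faithful `G`-subfield of transcendence degree at most `d - 2`, if `(ℤ/2)²` acts on the
leading coefficients through characters of the value group and `G` acts on them through its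
action on the coefficient field. -/
theorem exists_faithful_residue_subfield (h2 : (2 : F) ≠ 0)
    (hG : HasInvolutionCommutators G)
    (ρ : G × (ℤˣ × ℤˣ) →* (M ≃ₐ[K] M)) (φ : G →* (F ≃ₐ[K] F))
    (j : M →ₐ[K] HahnSeries Γ F) (χ : ℤˣ × ℤˣ → (Multiplicative Γ →* ℤˣ))
    (hχ : ∀ γ, χ 1 γ = 1)
    (hord : ∀ h x, (j (ρ h x)).order = (j x).order)
    (hlc : ∀ h x, (j (ρ h x)).leadingCoeff =
      ((χ h.2 (.ofAdd (j x).order) : ℤ) : F) * φ h.1 (j x).leadingCoeff)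
    (E : IntermediateField K M) (hE : ∀ h, ∀ x ∈ E, ρ h x ∈ E)
    (hfaith : ∀ h, h ≠ 1 → ∃ x ∈ E, ρ h x ≠ x) :
    ∃ E' : IntermediateField K F, (∀ g, ∀ x ∈ E', φ g x ∈ E') ∧
      (∀ g, g ≠ 1 → ∃ x ∈ E', φ g x ≠ x) ∧ trdeg K E' + 2 ≤ trdeg K E := by
  have hlc0 : ∀ {x : M}, x ≠ 0 → (j x).leadingCoeff ≠ 0 := fun {x} hx ↦
    leadingCoeff_ne_zero.2 (by simpa using hx)
  have hneg : ∀ a : F, a ≠ 0 → -a ≠ a := by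
    intro a ha h
    rw [neg_eq_iff_add_eq_zero, ← two_mul] at h
    exact (mul_ne_zero h2 ha) h
  have hsq : ∀ h : G × (ℤˣ × ℤˣ), h * h = 1 → ∀ x, ρ h (ρ h x) = x := by
    intro h hh x
    rw [← AlgEquiv.mul_apply, ← map_mul, hh, map_one, AlgEquiv.one_apply]
  have hlcG : ∀ (g : G) x, (j (ρ (g, 1) x)).leadingCoeff = φ g (j x).leadingCoeff := by
    intro g x
    rw [hlc]
    simp [hχ]
  have hstable : ∀ g : G, ∀ a ∈ hahnResidueField j E, φ g a ∈ hahnResidueField j E := by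
    intro g a ha
    by_cases ha0 : a = 0
    · rw [ha0, map_zero]
      exact zero_mem _
    obtain ⟨x, hx, hx0, hxord, rfl⟩ := (mem_hahnResidueField_of_ne_zero ha0).1 ha
    refine (mem_hahnResidueField_of_ne_zero (by simpa using ha0)).2
      ⟨ρ (g, 1) x, hE _ x hx, by simpa using hx0, by rw [hord, hxord], hlcG g x⟩
  refine ⟨hahnResidueField j E, hstable, ?_, ?_⟩
  · intro g₀ hg₀
    by_contra! hcon
    let N : Subgroup G :=
      { carrier := {g | ∀ a ∈ hahnResidueField j E, φ g a = a}
        one_mem' := by simp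
        mul_mem' := by
          intro g h hg hh a ha
          rw [map_mul, AlgEquiv.mul_apply, hh a ha, hg a ha]
        inv_mem' := by
          intro g hg a ha
          conv_lhs => rw [← hg a ha]
          rw [← AlgEquiv.mul_apply, ← map_mul, inv_mul_cancel, map_one, AlgEquiv.one_apply] }
    have hN : N.Normal := ⟨fun n hn g a ha ↦ by
      rw [map_mul, map_mul, AlgEquiv.mul_apply, AlgEquiv.mul_apply, hn _ (hstable _ a ha),
        ← AlgEquiv.mul_apply, ← map_mul, mul_inv_cancel, map_one, AlgEquiv.one_apply]⟩
    have hN' : N ≠ ⊥ := fun h ↦ hg₀ (Subgroup.mem_bot.1 (h ▸ (show g₀ ∈ N from hcon)))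
    obtain ⟨s, hs, g, hss, hu, huu⟩ := hG N hN hN'
    set w := g * s * g⁻¹ * s with hw
    obtain ⟨x, hx, hx0, hwx⟩ := exists_neg_eigenvector E (a := ρ (w, 1)) (hE _)
      (hsq _ (by ext <;> simp [huu])) (hfaith _ (by simpa using hu))
    set a := (j x).leadingCoeff with ha
    have ha0 : a ≠ 0 := hlc0 hx0
    have hwa : φ w a = -a := by
      rw [← hlcG, hwx, map_neg, leadingCoeff_neg]
    obtain ⟨c, hc, hca⟩ : ∃ c ∈ hahnResidueField j E, φ s a = c * a := by
      refine ⟨φ s a / a, ?_, by rw [div_mul_cancel₀ _ ha0]⟩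
      rw [ha, ← hlcG]
      exact div_mem_hahnResidueField j (hE _ x hx) hx (by simpa using hx0) hx0 (hord _ _)
    have hcc : c * c = 1 := by
      have : φ s (φ s a) = a := by
        rw [← AlgEquiv.mul_apply, ← map_mul, hss, map_one, AlgEquiv.one_apply]
      rw [hca, map_mul, hs c hc, hca, ← mul_assoc] at this
      exact mul_right_cancel₀ ha0 (this.trans (one_mul a).symm)
    obtain ⟨d, hd, hda⟩ : ∃ d ∈ hahnResidueField j E, φ g⁻¹ a = d * a := by
      refine ⟨φ g⁻¹ a / a, ?_, by rw [div_mul_cancel₀ _ ha0]⟩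
      rw [ha, ← hlcG]
      exact div_mem_hahnResidueField j (hE _ x hx) hx (by simpa using hx0) hx0 (hord _ _)
    have hfix : φ w a = a := by
      have hga : φ g (φ g⁻¹ a) = a := by
        rw [← AlgEquiv.mul_apply, ← map_mul, mul_inv_cancel, map_one, AlgEquiv.one_apply]
      have hginv : φ g⁻¹ c = c := by
        rcases mul_self_eq_one_iff.1 hcc with rfl | rfl <;> simp
      have hsa : φ s (φ g⁻¹ (φ s a)) = φ g⁻¹ a := by
        rw [hca, map_mul, hginv, map_mul, hs c hc, hda, map_mul, hs d hd, hca,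
          show c * (d * (c * a)) = (c * c) * (d * a) by ring, hcc, one_mul]
      rw [hw, map_mul, map_mul, map_mul, AlgEquiv.mul_apply, AlgEquiv.mul_apply,
        AlgEquiv.mul_apply, hsa, hga]
    rw [hfix] at hwa
    exact hneg a ha0 hwa.symm
  · have hsign : ∀ ε : ℤˣ, ε * ε = 1 := by decide
    obtain ⟨⟨x, hx, hx0, hax, hbx⟩, y, hy, hy0, hay, hby⟩ :=
      exists_dual_eigenvectors E (a := ρ (1, (-1, 1))) (b := ρ (1, (1, -1))) (hE _) (hE _)
        (hsq _ (by ext <;> simp)) (hsq _ (by ext <;> simp))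
        (fun x ↦ by
          rw [← AlgEquiv.mul_apply, ← map_mul, ← AlgEquiv.mul_apply, ← map_mul]; rfl)
        (hfaith _ (by simp)) (hfaith _ (by simp))
        (by
          simp_rw [← AlgEquiv.mul_apply, ← map_mul]
          exact hfaith _ (by simp))
    have hval : ∀ (v : ℤˣ × ℤˣ) (z : M), z ≠ 0 →
        (ρ (1, v) z = -z → χ v (.ofAdd (j z).order) = -1) ∧
        (ρ (1, v) z = z → χ v (.ofAdd (j z).order) = 1) := by
      intro v z hz
      have h := hlc (1, v) z
      rw [map_one, AlgEquiv.one_apply] at h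
      constructor
      · intro hvz
        refine (Int.units_eq_one_or _).resolve_left fun h1 ↦ ?_
        rw [hvz, map_neg, leadingCoeff_neg, h1] at h
        exact hneg _ (hlc0 hz) (by simpa using h)
      · intro hvz
        refine (Int.units_eq_one_or _).resolve_right fun h1 ↦ ?_
        rw [hvz, h1] at h
        exact hneg _ (hlc0 hz) (by simpa using h.symm)
    exact trdeg_hahnResidueField_add_two_le j E hx hy hx0 hy0
      (zsmul_independent_of_sign_characters (χ := χ (-1, 1)) (ψ := χ (1, -1))
        ((hval _ x hx0).1 hax) ((hval _ y hy0).2 hay) ((hval _ x hx0).2 hbx)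
        ((hval _ y hy0).1 hby))

end ResidueAction

section Twist

open HahnSeries

variable {F Γ : Type*} [Field F] [AddCommGroup Γ] [LinearOrder Γ] [IsOrderedAddMonoid Γ]

/-- The endomorphism of a field of Hahn series that applies `φ` to every coefficient and
multiplies the coefficient of exponent `γ` by the sign `χ γ`. -/
def hahnTwist (χ : Multiplicative Γ →* ℤˣ) (φ : F →+* F) : HahnSeries Γ F →+* HahnSeries Γ F where
  toFun x :=
    { coeff := fun γ ↦ ((χ (.ofAdd γ) : ℤ) : F) * φ (x.coeff γ)
      isPWO_support' := x.isPWO_support.mono fun γ hγ hx ↦ hγ (by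
        simp only [hx, map_zero, mul_zero]) }
  map_zero' := by ext; simp
  map_one' := by
    ext γ
    rcases eq_or_ne γ 0 with rfl | hγ
    · simp
    · simp [coeff_one, hγ]
  map_add' x y := by ext; simp [mul_add]
  map_mul' x y := by
    ext γ
    simp only [coeff_mul, map_sum, Finset.mul_sum]
    refine Finset.sum_congr ?_ fun p hp ↦ ?_
    · have hε : ∀ ε : ℤˣ, ((ε : ℤ) : F) ≠ 0 := fun ε ↦ by
        rcases Int.units_eq_one_or ε with rfl | rfl <;> simp
      ext p
      simp [hε]
    · rw [Finset.mem_antidiagonal] at hp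
      rw [← hp.2.2, ofAdd_add, map_mul, map_mul]
      push_cast
      ring

theorem hahnTwist_coeff (χ : Multiplicative Γ →* ℤˣ) (φ : F →+* F) (x : HahnSeries Γ F) (γ : Γ) :
    (hahnTwist χ φ x).coeff γ = ((χ (.ofAdd γ) : ℤ) : F) * φ (x.coeff γ) := rfl

theorem hahnTwist_C (χ : Multiplicative Γ →* ℤˣ) (φ : F →+* F) (a : F) :
    hahnTwist χ φ (C a) = C (φ a) := by
  ext γ
  rcases eq_or_ne γ 0 with rfl | hγ
  · simp [hahnTwist_coeff]
  · simp [hahnTwist_coeff, hγ]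

theorem hahnTwist_single (χ : Multiplicative Γ →* ℤˣ) (φ : F →+* F) (γ : Γ) (a : F) :
    hahnTwist χ φ (single γ a) = single γ (((χ (.ofAdd γ) : ℤ) : F) * φ a) := by
  ext δ
  rcases eq_or_ne δ γ with rfl | hγ
  · simp [hahnTwist_coeff]
  · simp [hahnTwist_coeff, coeff_single_of_ne hγ]

theorem hahnTwist_order (χ : Multiplicative Γ →* ℤˣ) (φ : F →+* F) (x : HahnSeries Γ F) :
    (hahnTwist χ φ x).order = x.order := by
  rcases eq_or_ne x 0 with rfl | hx
  · simp
  have hε : ∀ ε : ℤˣ, ((ε : ℤ) : F) ≠ 0 := fun ε ↦ by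
    rcases Int.units_eq_one_or ε with rfl | rfl <;> simp
  apply le_antisymm
  · apply order_le_of_coeff_ne_zero
    rw [hahnTwist_coeff]
    exact mul_ne_zero (hε _) (by simpa using mt coeff_order_eq_zero.1 hx)
  · apply order_le_of_coeff_ne_zero
    have h := mt coeff_order_eq_zero.1 (by simpa using hx : hahnTwist χ φ x ≠ 0)
    rw [hahnTwist_coeff] at h
    simpa using right_ne_zero_of_mul h

theorem hahnTwist_leadingCoeff (χ : Multiplicative Γ →* ℤˣ) (φ : F →+* F) (x : HahnSeries Γ F) :
    (hahnTwist χ φ x).leadingCoeff = ((χ (.ofAdd x.order) : ℤ) : F) * φ x.leadingCoeff := by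
  rw [leadingCoeff_eq, leadingCoeff_eq, hahnTwist_order, hahnTwist_coeff]

end Twist

section Monomials

open HahnSeries MvPolynomial

variable {F ι : Type*} [Field F] [Fintype ι] [LinearOrder ι]

/-- The monomial embedding of a polynomial ring into the Hahn series with exponents in the
lexicographically ordered group `ℤ^ι`. -/
def hahnMonomial (F ι : Type*) [Field F] [Fintype ι] [LinearOrder ι] :
    MvPolynomial ι F →ₐ[F] HahnSeries (Lex (ι → ℤ)) F :=
  MvPolynomial.aeval fun i ↦ single (toLex (Pi.single i 1)) 1

theorem hahnMonomial_monomial (m : ι →₀ ℕ) (a : F) :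
    hahnMonomial F ι (monomial m a) = single (toLex fun i ↦ (m i : ℤ)) a := by
  rw [hahnMonomial, aeval_monomial, Finsupp.prod_fintype _ _ (by simp)]
  have h : ∀ s : Finset ι, ∏ i ∈ s, (single (toLex (Pi.single i (1 : ℤ))) (1 : F)) ^ m i =
      single (∑ i ∈ s, m i • toLex (Pi.single i (1 : ℤ))) 1 := by
    intro s
    induction s using Finset.induction_on with
    | empty => simp
    | insert i s hi ih => rw [Finset.prod_insert hi, Finset.sum_insert hi, ih]; simp [single_pow]
  rw [h, show algebraMap F (HahnSeries (Lex (ι → ℤ)) F) a = HahnSeries.C a from rfl, HahnSeries.C_apply,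
    single_mul_single, zero_add, mul_one]
  congr 2
  refine funext fun i ↦ ?_
  change (∑ j, m j • (Pi.single j (1 : ℤ) : ι → ℤ)) i = _
  simp [Finset.sum_apply, Pi.single_apply]

theorem hahnMonomial_injective : Function.Injective (hahnMonomial F ι) := by
  rw [injective_iff_map_eq_zero]
  intro p hp
  ext m
  have h : ∀ p : MvPolynomial ι F,
      (hahnMonomial F ι p).coeff (toLex fun i ↦ (m i : ℤ)) = coeff m p := by
    intro p
    induction p using MvPolynomial.induction_on' with
    | monomial n a =>
      rw [hahnMonomial_monomial, coeff_monomial]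
      split_ifs with hnm
      · rw [hnm, coeff_single_same]
      · rw [coeff_single_of_ne]
        intro h
        refine hnm (Finsupp.ext fun i ↦ ?_)
        exact_mod_cast (congrFun (toLex.injective h) i).symm
    | add p q hp hq => rw [map_add, coeff_add', Pi.add_apply, hp, hq, MvPolynomial.coeff_add]
  rw [← h, hp]
  simp

end Monomials

section FnVar

open MvPolynomial

variable {K σ : Type*} [Field K]

/-- The variable `x_i` of the rational function field. -/
def fnVar (K : Type*) [Field K] {σ : Type*} (i : σ) : FnField K σ :=
  algebraMap (MvPolynomial σ K) (FnField K σ) (X i)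

theorem fnVar_injective : Function.Injective (fnVar K : σ → FnField K σ) :=
  (IsFractionRing.injective (MvPolynomial σ K) (FnField K σ)).comp X_injective

theorem fnField_ringHom_ext {R : Type*} [Field R] {f g : FnField K σ →+* R}
    (hC : ∀ a : K, f (algebraMap K _ a) = g (algebraMap K _ a))
    (hX : ∀ i, f (fnVar K i) = g (fnVar K i)) : f = g := by
  refine IsLocalization.ringHom_ext (nonZeroDivisors (MvPolynomial σ K)) ?_
  refine MvPolynomial.ringHom_ext (fun a ↦ ?_) hX
  simpa [IsScalarTower.algebraMap_apply K (MvPolynomial σ K) (FnField K σ),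
    MvPolynomial.algebraMap_eq] using hC a

theorem galAction_fnVar {G : Type*} [Group G] (g h : G) :
    galAction K G g (fnVar K h) = fnVar K (g * h) := by
  change IsFractionRing.fieldEquivOfAlgEquiv K _ _ _ _ = _
  simp [fnVar, permHom]

end FnVar

section EssentialDimension

variable {K : Type*} [Field K] {G : Type*} [Group G]

theorem trdeg_lt_aleph0_of_finite {σ : Type*} [Finite σ] (E : IntermediateField K (FnField K σ)) :
    trdeg K E < .aleph0 := by
  have : Algebra.EssFiniteType (MvPolynomial σ K) (FnField K σ) :=
    .of_isLocalization _ (nonZeroDivisors (MvPolynomial σ K))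
  have : Algebra.EssFiniteType K (FnField K σ) := .comp K (MvPolynomial σ K) _
  exact (trdeg_le_of_injective E.val E.val.injective).trans_lt
    (trdeg_lt_aleph0 K (FnField K σ))

theorem edK_le_of_trdeg_le [Finite G] (E : IntermediateField K (FnField K G))
    (hE : ∀ g : G, ∀ x ∈ E, galAction K G g x ∈ E)
    (hfaith : ∀ g : G, g ≠ 1 → ∃ x ∈ E, galAction K G g x ≠ x) {d : ℕ} (hd : trdeg K E ≤ d) :
    edK K G ≤ d := by
  obtain ⟨m, hm⟩ := Cardinal.lt_aleph0.1 (trdeg_lt_aleph0_of_finite E)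
  have h : edK K G ≤ m := Nat.sInf_le ⟨E, hE, hfaith, hm⟩
  refine h.trans ?_
  exact_mod_cast hm ▸ hd

theorem exists_trdeg_eq_edK (K : Type*) [Field K] (G : Type*) [Group G] [Finite G] :
    ∃ E : IntermediateField K (FnField K G),
      (∀ g : G, ∀ x ∈ E, galAction K G g x ∈ E) ∧
      (∀ g : G, g ≠ 1 → ∃ x ∈ E, galAction K G g x ≠ x) ∧ trdeg K E = edK K G := by
  obtain ⟨m, hm⟩ := Cardinal.lt_aleph0.1
    (trdeg_lt_aleph0_of_finite (⊤ : IntermediateField K (FnField K G)))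
  refine Nat.sInf_mem (s := {d : ℕ | ∃ E : IntermediateField K (FnField K G),
    (∀ g : G, ∀ x ∈ E, galAction K G g x ∈ E) ∧
    (∀ g : G, g ≠ 1 → ∃ x ∈ E, galAction K G g x ≠ x) ∧ trdeg K E = d})
    ⟨m, ⊤, fun _ _ _ ↦ trivial, fun g hg ↦ ⟨fnVar K 1, trivial, ?_⟩, hm⟩
  rw [galAction_fnVar, mul_one]
  exact fnVar_injective.ne hg

end EssentialDimension

section Vandermonde

open Matrix
open scoped Kronecker

theorem exists_powers_rightInverse {F α : Type*} [Field F] [Fintype α] [DecidableEq α]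
    {v : α → F} (hv : Function.Injective v) :
    ∃ (e : α → ℕ) (W : Matrix α α F), Matrix.of (fun a b ↦ v a ^ e b) * W = 1 := by
  let f := Fintype.equivFin α
  refine ⟨fun b ↦ f b, (Matrix.of fun a b ↦ v a ^ (f b : ℕ))⁻¹, ?_⟩
  refine Matrix.mul_nonsing_inv _ (isUnit_iff_ne_zero.2 ?_)
  have h : (Matrix.of fun a b ↦ v a ^ (f b : ℕ)) =
      (vandermonde (v ∘ f.symm)).submatrix f f := by
    ext a b
    simp [vandermonde_apply]
  rw [h, det_submatrix_equiv_self, det_vandermonde_ne_zero_iff]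
  exact hv.comp f.symm.injective

open MvPolynomial in
theorem algebraicIndependent_linear_forms {F B ι : Type*} [Field F] [Fintype B] [DecidableEq B]
    [Fintype ι] (A : Matrix B ι F) (W : Matrix ι B F) (h : A * W = 1) :
    AlgebraicIndependent F fun b ↦ ∑ i, C (A b i) * (X i : MvPolynomial ι F) := by
  have hinv : ((aeval fun i ↦ ∑ b, C (W i b) * (X b : MvPolynomial B F)).comp
      (aeval fun b ↦ ∑ i, C (A b i) * (X i : MvPolynomial ι F)) :
      MvPolynomial B F →ₐ[F] MvPolynomial B F) = AlgHom.id F _ := by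
    refine MvPolynomial.algHom_ext fun b ↦ ?_
    simp only [AlgHom.comp_apply, aeval_X, map_sum, map_mul, AlgHom.id_apply,
      algHom_C, MvPolynomial.algebraMap_eq, Finset.mul_sum]
    rw [Finset.sum_comm]
    calc ∑ b', ∑ i, C (A b i) * (C (W i b') * X b') = ∑ b', C ((A * W) b b') * X b' := by
          simp only [Matrix.mul_apply, map_sum, map_mul, Finset.sum_mul, mul_assoc]
      _ = X b := by simp [h, Matrix.one_apply]
  exact Function.LeftInverse.injective (g := aeval fun i ↦ ∑ b, C (W i b) * X b)
    fun p ↦ DFunLike.congr_fun hinv p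

end Vandermonde

section EquivariantEmbedding

open MvPolynomial

theorem exists_leftCoset_decomposition {H B : Type*} [Group H] [Group B] {ψ : H →* B}
    (hψ : Function.Injective ψ) :
    ∃ (r : B → B) (c : B → H), (∀ b, b = ψ (c b) * r b) ∧ (∀ h b, r (ψ h * b) = r b) ∧
      ∀ h b, c (ψ h * b) = h * c b := by
  let q : B → Quotient (QuotientGroup.rightRel ψ.range) := Quotient.mk _
  have hr : ∀ b, ∃ h, ψ h = b * (q b).out⁻¹ := fun b ↦
    QuotientGroup.rightRel_apply.1 (Quotient.exact (q b).out_eq)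
  choose c hc using hr
  have hb : ∀ b, b = ψ (c b) * (q b).out := fun b ↦ by rw [hc, inv_mul_cancel_right]
  have hq : ∀ h b, (q (ψ h * b)).out = (q b).out := fun h b ↦ by
    congr 1
    exact Quotient.sound (QuotientGroup.rightRel_apply.2 ⟨h⁻¹, by simp⟩)
  refine ⟨fun b ↦ (q b).out, c, hb, hq, fun h b ↦ hψ ?_⟩
  rw [hc, hq, map_mul, hc, mul_assoc]

theorem exists_equivariant_matrix {K G : Type*} [Field K] (h2 : (2 : K) ≠ 0) [Group G]
    [Fintype G] [DecidableEq G] :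
    ∃ (V W : Matrix (G × (ℤˣ × ℤˣ)) (G × (ℤˣ × ℤˣ)) (FnField K G))
      (s : G × (ℤˣ × ℤˣ) → ℤˣ × ℤˣ → ℤˣ), V * W = 1 ∧ (∀ k, s k 1 = 1) ∧
      ∀ h a k, V (h * a) k = ((s k h.2 : ℤ) : FnField K G) * galAction K G h.1 (V a k) := by
  obtain ⟨e, W, hW⟩ := exists_powers_rightInverse (fnVar_injective (K := K) (σ := G))
  have hF : (2 : FnField K G) ≠ 0 := by
    rw [← map_ofNat (algebraMap K (FnField K G)) 2]
    simpa using h2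
  have hv : Function.Injective fun ε : ℤˣ ↦ ((ε : ℤ) : FnField K G) := by
    have hne : (1 : FnField K G) ≠ -1 := fun h ↦ hF (by
      rw [← one_add_one_eq_two]
      nth_rewrite 2 [h]
      simp)
    intro ε δ h
    rcases Int.units_eq_one_or ε with rfl | rfl <;> rcases Int.units_eq_one_or δ with rfl | rfl
    · rfl
    · simp at h; exact absurd h hne
    · simp at h; exact absurd h.symm hne
    · rfl
  obtain ⟨f, W', hW'⟩ := exists_powers_rightInverse hv
  refine ⟨.kroneckerMap (· * ·) (.of fun a b ↦ fnVar K a ^ e b)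
      (.kroneckerMap (· * ·) (.of fun a b ↦ ((a : ℤ) : FnField K G) ^ f b)
        (.of fun a b ↦ ((a : ℤ) : FnField K G) ^ f b)),
    .kroneckerMap (· * ·) W (.kroneckerMap (· * ·) W' W'),
    fun k v ↦ v.1 ^ f k.2.1 * v.2 ^ f k.2.2, ?_, by simp, fun h a k ↦ ?_⟩
  · rw [← Matrix.mul_kronecker_mul, ← Matrix.mul_kronecker_mul, hW, hW',
      Matrix.one_kronecker_one, Matrix.one_kronecker_one]
  · simp only [Matrix.kroneckerMap_apply, Matrix.of_apply, Prod.fst_mul, Prod.snd_mul, map_mul,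
      map_pow, galAction_fnVar, map_intCast, Units.val_mul, Int.cast_mul, Units.val_pow_eq_pow_val,
      Int.cast_pow, mul_pow]
    ring

/-- The sign character of `ℤ^ι` with value `s i` on the `i`-th generator. -/
def lexSign {ι : Type*} [Fintype ι] (s : ι → ℤˣ) : Multiplicative (Lex (ι → ℤ)) →* ℤˣ where
  toFun γ := ∏ i, s i ^ ofLex γ.toAdd i
  map_one' := Finset.prod_eq_one fun i _ ↦ zpow_zero (s i)
  map_mul' γ δ := by
    rw [← Finset.prod_mul_distrib]
    exact Finset.prod_congr rfl fun i _ ↦ zpow_add (s i) _ _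

theorem lexSign_single {ι : Type*} [Fintype ι] [DecidableEq ι] (s : ι → ℤˣ) (i : ι) :
    lexSign s (.ofAdd (toLex (Pi.single i 1))) = s i := by
  simp only [lexSign, MonoidHom.coe_mk, OneHom.coe_mk, toAdd_ofAdd, ofLex_toLex]
  rw [Finset.prod_eq_single i (fun j _ hj ↦ by simp [hj]) (by simp)]
  simp

theorem exists_algHom_fnField {K L σ : Type*} [Field K] [Field L] [Algebra K L] {x : σ → L}
    (hx : AlgebraicIndependent K x) : ∃ j : FnField K σ →ₐ[K] L, ∀ b, j (fnVar K b) = x b :=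
  have hx' : Function.Injective (aeval x : MvPolynomial σ K →ₐ[K] L) := hx
  ⟨IsFractionRing.liftAlgHom hx', fun b ↦ by
    rw [IsFractionRing.liftAlgHom_apply, fnVar, IsFractionRing.lift_algebraMap]
    exact aeval_X x b⟩

theorem exists_algHom_hahnSeries {K F B ι : Type*} [Field K] [Field F] [Algebra K F] [Fintype B]
    [DecidableEq B] [Fintype ι] [LinearOrder ι] (A : Matrix B ι F) (D : Matrix ι B F)
    (hAD : A * D = 1) :
    ∃ j : FnField K B →ₐ[K] HahnSeries (Lex (ι → ℤ)) F,
      ∀ b, j (fnVar K b) = ∑ i, HahnSeries.single (toLex (Pi.single i 1)) (A b i) := by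
  have h := (algebraicIndependent_linear_forms A D hAD).map'
    (f := hahnMonomial F ι) hahnMonomial_injective
  have hx : (hahnMonomial F ι ∘ fun b ↦ ∑ i, C (A b i) * X i) =
      fun b ↦ ∑ i, HahnSeries.single (toLex (Pi.single i 1)) (A b i) := by
    ext1 b
    simp only [Function.comp_apply, map_sum, map_mul, hahnMonomial, aeval_X, algHom_C]
    refine Finset.sum_congr rfl fun i _ ↦ ?_
    rw [show algebraMap F (HahnSeries (Lex (ι → ℤ)) F) (A b i) =
      HahnSeries.C (A b i) from rfl, HahnSeries.C_apply, HahnSeries.single_mul_single, zero_add,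
      mul_one]
  rw [hx] at h
  exact exists_algHom_fnField (AlgebraicIndependent.restrictScalars (algebraMap K F).injective h)

theorem exists_equivariant_embedding {K : Type*} [Field K] (h2 : (2 : K) ≠ 0) {G B : Type}
    [Group G] [Finite G] [Group B] [Finite B] {ψ : G × (ℤˣ × ℤˣ) →* B}
    (hψ : Function.Injective ψ) :
    ∃ (n : ℕ) (j : FnField K B →ₐ[K] HahnSeries (Lex (Fin n → ℤ)) (FnField K G))
      (χ : ℤˣ × ℤˣ → (Multiplicative (Lex (Fin n → ℤ)) →* ℤˣ)), (∀ γ, χ 1 γ = 1) ∧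
      ∀ h x, j (galAction K B (ψ h) x) =
        hahnTwist (χ h.2) (galAction K G h.1 : FnField K G →+* FnField K G) (j x) := by
  classical
  have := Fintype.ofFinite G
  have := Fintype.ofFinite B
  obtain ⟨V, W, s, hVW, hs, hV⟩ := exists_equivariant_matrix (G := G) h2
  obtain ⟨r, c, hb, hr, hc⟩ := exists_leftCoset_decomposition hψ
  let e := Fintype.equivFin (B × (G × (ℤˣ × ℤˣ)))
  let A : Matrix B (Fin _) (FnField K G) := .of fun b i ↦
    if (e.symm i).1 = r b then V (c b) (e.symm i).2 else 0
  let D : Matrix (Fin _) B (FnField K G) := .of fun i b ↦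
    if (e.symm i).1 = r b then W (e.symm i).2 (c b) else 0
  have hAD : A * D = 1 := by
    ext b b'
    rw [Matrix.mul_apply, ← e.sum_comp, Fintype.sum_prod_type]
    simp only [A, D, Matrix.of_apply, Equiv.symm_apply_apply, ite_mul, zero_mul, mul_ite, mul_zero]
    rw [Finset.sum_eq_single (r b) (fun q _ hq ↦ by simp [hq]) (by simp)]
    simp only [if_true]
    by_cases hbb : r b = r b'
    · simp only [hbb, if_true]
      rw [← Matrix.mul_apply, hVW, Matrix.one_apply, Matrix.one_apply]
      refine if_congr ⟨fun h ↦ ?_, fun h ↦ h ▸ rfl⟩ rfl rfl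
      rw [hb b, hb b', h, hbb]
    · simp only [hbb, if_false, Finset.sum_const_zero]
      rw [Matrix.one_apply_ne (fun h ↦ hbb (congrArg r h))]
  obtain ⟨j, hj⟩ := exists_algHom_hahnSeries (K := K) A D hAD
  let χ : ℤˣ × ℤˣ → (Multiplicative (Lex (Fin _ → ℤ)) →* ℤˣ) := fun v ↦
    lexSign fun i ↦ s (e.symm i).2 v
  refine ⟨_, j, χ, fun γ ↦ ?_, fun h ↦ ?_⟩
  · simp [χ, lexSign, hs]
  · refine RingHom.congr_fun (f := (RingHomClass.toRingHom j).comp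
      (galAction K B (ψ h) : FnField K B →+* FnField K B))
      (g := (hahnTwist (χ h.2) (galAction K G h.1 : FnField K G →+* FnField K G)).comp
        (RingHomClass.toRingHom j))
      (fnField_ringHom_ext (fun a ↦ ?_) fun b ↦ ?_)
    · simp only [RingHom.comp_apply, RingHom.coe_coe, AlgEquiv.commutes, AlgHom.commutes]
      rw [show algebraMap K (HahnSeries (Lex (Fin _ → ℤ)) (FnField K G)) a =
        HahnSeries.C (algebraMap K (FnField K G) a) from rfl, hahnTwist_C]
      simp
    · simp only [RingHom.comp_apply, RingHom.coe_coe, galAction_fnVar, hj, map_sum,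
        hahnTwist_single]
      refine Finset.sum_congr rfl fun i _ ↦ ?_
      congr 1
      simp only [χ, lexSign_single, A, Matrix.of_apply, hr, hc, hV]
      split_ifs <;> simp

theorem edK_add_two_le {K : Type*} [Field K] (h2 : (2 : K) ≠ 0) {G B : Type}
    [Group G] [Finite G] [Group B] [Finite B] (hG : HasInvolutionCommutators G)
    {ψ : G × (ℤˣ × ℤˣ) →* B} (hψ : Function.Injective ψ) : edK K G + 2 ≤ edK K B := by
  obtain ⟨n, j, χ, hχ, hj⟩ := exists_equivariant_embedding h2 hψ
  obtain ⟨E, hE, hfaith, hd⟩ := exists_trdeg_eq_edK K B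
  have hF : (2 : FnField K G) ≠ 0 := by
    rw [← map_ofNat (algebraMap K (FnField K G)) 2]
    simpa using h2
  obtain ⟨E', hE', hfaith', hle⟩ := exists_faithful_residue_subfield hF hG
    ((galAction K B).comp ψ) (galAction K G) j χ hχ
    (fun h x ↦ by
      rw [MonoidHom.comp_apply, hj, hahnTwist_order])
    (fun h x ↦ by
      rw [MonoidHom.comp_apply, hj, hahnTwist_leadingCoeff]; rfl)
    E (fun h ↦ hE (ψ h)) (fun h hh ↦ hfaith (ψ h) ((map_ne_one_iff ψ hψ).2 hh))
  obtain ⟨m, hm⟩ := Cardinal.lt_aleph0.1 (trdeg_lt_aleph0_of_finite E')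
  have h : edK K G ≤ m := edK_le_of_trdeg_le E' hE' hfaith' hm.le
  rw [hm, hd] at hle
  have : m + 2 ≤ edK K B := by exact_mod_cast hle
  lia

end EquivariantEmbedding

section AlternatingGroup

open Equiv Equiv.Perm

theorem exists_commutator_involution_of_ne_one :
    ∀ h : Perm (Fin 4), sign h = 1 → h ≠ 1 → ∃ k : Perm (Fin 4), sign k = 1 ∧
      ∃ g : Perm (Fin 4), sign g = 1 ∧ (h * k * h⁻¹ * k⁻¹) * (h * k * h⁻¹ * k⁻¹) = 1 ∧
      g * (h * k * h⁻¹ * k⁻¹) * g⁻¹ * (h * k * h⁻¹ * k⁻¹) ≠ 1 ∧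
      (g * (h * k * h⁻¹ * k⁻¹) * g⁻¹ * (h * k * h⁻¹ * k⁻¹)) *
        (g * (h * k * h⁻¹ * k⁻¹) * g⁻¹ * (h * k * h⁻¹ * k⁻¹)) = 1 := by
  decide +kernel

/-- The product of permutations of `Fin m` and `Fin n` acting on consecutive blocks. -/
def finSumPerm (m n : ℕ) : Perm (Fin m) × Perm (Fin n) →* Perm (Fin (m + n)) :=
  (finSumFinEquiv.permCongrHom.toMonoidHom :
    Perm (Fin m ⊕ Fin n) →* Perm (Fin (m + n))).comp (sumCongrHom (Fin m) (Fin n))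

theorem finSumPerm_injective (m n : ℕ) : Function.Injective (finSumPerm m n) :=
  (finSumFinEquiv (m := m) (n := n)).permCongrHom.injective.comp sumCongrHom_injective

theorem sign_finSumPerm {m n : ℕ} (p : Perm (Fin m) × Perm (Fin n)) :
    sign (finSumPerm m n p) = sign p.1 * sign p.2 :=
  (sign_permCongr finSumFinEquiv _).trans (sign_sumCongr _ _)

theorem hasInvolutionCommutators_alternatingGroup {n : ℕ} (hn : 4 ≤ n) :
    HasInvolutionCommutators (alternatingGroup (Fin n)) := by
  intro N hN hN'
  rcases hn.eq_or_lt with rfl | hn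
  · obtain ⟨⟨h, hh⟩, h1⟩ := Subgroup.ne_bot_iff_exists_ne_one.1 hN'
    replace h1 : h ≠ 1 := fun h' ↦ h1 (Subtype.ext h')
    obtain ⟨k, hk, g, hg, hss, hu, huu⟩ :=
      exists_commutator_involution_of_ne_one h.1 h.2 fun h' ↦ h1 (Subtype.ext h')
    let k' : alternatingGroup (Fin 4) := ⟨k, hk⟩
    refine ⟨h * k' * h⁻¹ * k'⁻¹, ?_, ⟨g, hg⟩, Subtype.ext hss,
      fun h' ↦ hu (congrArg Subtype.val h'), Subtype.ext huu⟩
    rw [mul_assoc, mul_assoc, ← mul_assoc k']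
    exact mul_mem hh (hN.conj_mem _ (inv_mem hh) _)
  · obtain ⟨m, rfl⟩ := Nat.exists_eq_add_of_le' hn.le
    have := alternatingGroup.isSimpleGroup (α := Fin (m + 4)) (by rw [Nat.card_fin]; exact hn)
    obtain rfl : N = ⊤ := (hN.eq_bot_or_eq_top).resolve_left hN'
    obtain ⟨k, hk, g, hg, hss, hu, huu⟩ :=
      exists_commutator_involution_of_ne_one c[0, 1, 2] (by decide +kernel) (by decide +kernel)
    have hs : sign (c[0, 1, 2] * k * c[0, 1, 2]⁻¹ * k⁻¹) = 1 := by
      rw [Perm.sign_mul, Perm.sign_mul, Perm.sign_mul, sign_inv, sign_inv, hk, mul_one, mul_one,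
        Int.units_mul_self]
    generalize c[0, 1, 2] * k * c[0, 1, 2]⁻¹ * k⁻¹ = s at hs hss hu huu
    let θ := (finSumPerm m 4).comp (MonoidHom.inr _ _)
    have hθ : Function.Injective θ := (finSumPerm_injective m 4).comp (Prod.mk_right_injective 1)
    have hsign : ∀ p, sign (θ p) = sign p := fun p ↦ by
      simp [θ, sign_finSumPerm]
    refine ⟨⟨θ s, (hsign s).trans hs⟩, trivial, ⟨θ g, (hsign g).trans hg⟩, Subtype.ext ?_,
      fun h' ↦ hu (hθ ?_), Subtype.ext ?_⟩
    · simpa using congrArg θ hss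
    · simpa using congrArg Subtype.val h'
    · simpa using congrArg θ huu

/-- The two commuting double transpositions `(01)(23)` and `(02)(13)`. -/
def kleinFourHom : ℤˣ × ℤˣ →* Perm (Fin 4) where
  toFun v := (if v.1 = 1 then 1 else swap 0 1 * swap 2 3) *
    if v.2 = 1 then 1 else swap 0 2 * swap 1 3
  map_one' := by decide
  map_mul' := by decide +kernel

theorem exists_alternatingGroup_prod_embedding (n : ℕ) :
    ∃ ψ : alternatingGroup (Fin n) × (ℤˣ × ℤˣ) →* alternatingGroup (Fin (n + 4)),
      Function.Injective ψ := by
  have hinj : Function.Injective kleinFourHom := by decide +kernel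
  have hsign : ∀ v, sign (kleinFourHom v) = 1 := by decide +kernel
  let θ := (finSumPerm n 4).comp ((alternatingGroup (Fin n)).subtype.prodMap kleinFourHom)
  have hθ : Function.Injective θ :=
    (finSumPerm_injective n 4).comp (Subtype.val_injective.prodMap hinj)
  refine ⟨θ.codRestrict _ fun p ↦ ?_, fun p q h ↦ hθ (congrArg Subtype.val h)⟩
  exact (sign_finSumPerm _).trans (by simp [hsign, mem_alternatingGroup.1 p.1.2])

theorem edK_alternatingGroup_add_two_le {K : Type*} [Field K] (h2 : (2 : K) ≠ 0) {n : ℕ}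
    (hn : 4 ≤ n) :
    edK K (alternatingGroup (Fin n)) + 2 ≤ edK K (alternatingGroup (Fin (n + 4))) := by
  obtain ⟨ψ, hψ⟩ := exists_alternatingGroup_prod_embedding n
  exact edK_add_two_le h2 (hasInvolutionCommutators_alternatingGroup hn) hψ

theorem two_le_edK_alternatingGroup {K : Type*} [Field K] (h2 : (2 : K) ≠ 0) (n : ℕ) :
    2 ≤ edK K (alternatingGroup (Fin (n + 4))) := by
  obtain ⟨ψ, hψ⟩ := exists_alternatingGroup_prod_embedding n
  have hψ' : Function.Injective (ψ.comp ((1 : Unit →* _).prodMap (MonoidHom.id (ℤˣ × ℤˣ)))) :=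
    hψ.comp (fun p q h ↦ Prod.ext rfl (congrArg Prod.snd h :))
  have := edK_add_two_le h2 (fun N _ hN ↦ absurd (Subsingleton.elim N ⊥) hN) hψ'
  lia

end AlternatingGroup

section ConstantField

open MvPolynomial

theorem one_le_edK {K : Type*} [Field K] {G : Type*} [Group G] [Finite G] [Nontrivial G] :
    1 ≤ edK K G := by
  obtain ⟨E, -, hfaith, hd⟩ := exists_trdeg_eq_edK K G
  by_contra! h0
  rw [Nat.lt_one_iff.1 h0, Nat.cast_zero, trdeg_eq_algebraTrdeg, trdeg_eq_zero_iff] at hd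
  obtain ⟨g, hg⟩ := exists_ne (1 : G)
  obtain ⟨x, hx, hgx⟩ := hfaith g hg
  have hx : IsAlgebraic K x := (hd.isAlgebraic ⟨x, hx⟩).algHom E.val
  rcases eq_or_ne x 0 with rfl | hx0
  · simp at hgx
  have hpoly : ∀ y : FnField K G, IsAlgebraic K y → ∃ p : MvPolynomial G K, algebraMap _ _ p = y :=
    fun y hy ↦ IsIntegrallyClosed.isIntegral_iff.1 (hy.isIntegral.tower_top)
  obtain ⟨p, rfl⟩ := hpoly x hx
  obtain ⟨q, hq⟩ := hpoly _ hx.inv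
  have hp : IsUnit p := by
    refine IsUnit.of_mul_eq_one q (IsFractionRing.injective (MvPolynomial G K) (FnField K G) ?_)
    rw [map_mul, hq, mul_inv_cancel₀ hx0, map_one]
  obtain ⟨a, -, rfl⟩ := MvPolynomial.isUnit_iff_eq_C_of_isReduced.1 hp
  refine hgx ?_
  rw [← MvPolynomial.algebraMap_eq, ← IsScalarTower.algebraMap_apply, AlgEquiv.commutes]

end ConstantField

section UpperBound

open MvPolynomial

open scoped IntermediateField.algebraAdjoinAdjoin in
theorem trdeg_adjoin_le {K M : Type*} [Field K] [Field M] [Algebra K M] (T : Set M) :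
    trdeg K (IntermediateField.adjoin K T) ≤ Cardinal.mk T := by
  have h0 : Algebra.trdeg (Algebra.adjoin K T) (IntermediateField.adjoin K T) = 0 := trdeg_eq_zero
  have h1 : Algebra.trdeg K (aeval (R := K) ((↑) : T → M)).range ≤ Cardinal.mk T := by
    have h := lift_trdeg_le_of_surjective (aeval (R := K) ((↑) : T → M)).rangeRestrict
      (AlgHom.rangeRestrict_surjective _)
    rw [MvPolynomial.trdeg_of_isDomain] at h
    simpa using h
  rw [← Algebra.adjoin_range_eq_range_aeval, Subtype.range_coe] at h1
  rwa [trdeg_eq_algebraTrdeg, ← trdeg_add_eq K (Algebra.adjoin K T), h0, add_zero]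

section Criterion

variable {K : Type*} [Field K] {G : Type*} [Group G]

theorem edK_le_of_subset_adjoin [Finite G] {S T : Set (FnField K G)} {d : ℕ}
    (hS : ∀ g, ∀ s ∈ S, galAction K G g s ∈ S)
    (hfaith : ∀ g : G, g ≠ 1 → ∃ s ∈ S, galAction K G g s ≠ s)
    (hST : S ⊆ IntermediateField.adjoin K T) (hT : Cardinal.mk T ≤ d) : edK K G ≤ d := by
  refine edK_le_of_trdeg_le (IntermediateField.adjoin K S) (fun g ↦ ?_) (fun g hg ↦ ?_) ?_
  · change IntermediateField.adjoin K S ≤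
      (IntermediateField.adjoin K S).comap (galAction K G g).toAlgHom
    exact IntermediateField.adjoin_le_iff.2
      fun s hs ↦ IntermediateField.subset_adjoin K S (hS g s hs)
  · obtain ⟨s, hs, hgs⟩ := hfaith g hg
    exact ⟨s, IntermediateField.subset_adjoin K S hs, hgs⟩
  · have h := IntermediateField.adjoin_le_iff.2 hST
    exact (trdeg_le_of_injective (IntermediateField.inclusion h)
      (IntermediateField.inclusion_injective h)).trans ((trdeg_adjoin_le T).trans hT)

theorem exists_galAction_ne_of_isSimpleGroup [IsSimpleGroup G] {S : Set (FnField K G)}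
    (hS : ∀ g, ∀ s ∈ S, galAction K G g s ∈ S)
    (hmoved : ∃ g, ∃ s ∈ S, galAction K G g s ≠ s) (g : G) (hg : g ≠ 1) :
    ∃ s ∈ S, galAction K G g s ≠ s := by
  let N : Subgroup G :=
    { carrier := {g | ∀ s ∈ S, galAction K G g s = s}
      one_mem' := fun s _ ↦ by simp
      mul_mem' := fun {g h} hg hh s hs ↦ by
        rw [map_mul, AlgEquiv.mul_apply, hh s hs, hg s hs]
      inv_mem' := fun {g} hg s hs ↦ by
        rw [map_inv, AlgEquiv.aut_inv, AlgEquiv.symm_apply_eq, hg s hs] }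
  have hN : N.Normal := ⟨fun n hn g s hs ↦ by
    rw [map_mul, map_mul, AlgEquiv.mul_apply, AlgEquiv.mul_apply, hn _ (hS _ s hs),
      ← AlgEquiv.mul_apply, ← map_mul, mul_inv_cancel, map_one, AlgEquiv.one_apply]⟩
  by_contra! hfix
  rcases hN.eq_bot_or_eq_top with h | h
  · exact hg (Subgroup.mem_bot.1 (h ▸ (hfix : g ∈ N)))
  · obtain ⟨g', s, hs, hne⟩ := hmoved
    exact hne ((h ▸ Subgroup.mem_top g' : g' ∈ N) s hs)

end Criterion

section OrbitSum

variable (K : Type*) [Field K] {G : Type*} [Group G] [Fintype G] {α : Type*} [DecidableEq α]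
  [MulAction G α] (a : α)

/-- The sum of the variables `x_g` over all `g` that move `a` to `i`. -/
def orbitSum (i : α) : MvPolynomial G K := ∑ g : G with g • a = i, X g

/-- The sum of the variables `x_g` over all `g` that move `a` to `i`, as a rational function. -/
def orbitVar (i : α) : FnField K G :=
  algebraMap (MvPolynomial G K) (FnField K G) (orbitSum K a i)

variable {K}

theorem exists_algHom_orbitSum [MulAction.IsPretransitive G α] (c : α → K) :
    ∃ θ : MvPolynomial G K →ₐ[K] K, ∀ i, θ (orbitSum K a i) = c i := by
  classical
  choose r hr using fun i : α ↦ MulAction.exists_smul_eq G a i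
  refine ⟨aeval fun g ↦ if g = r (g • a) then c (g • a) else 0, fun i ↦ ?_⟩
  have h : ∀ g ∈ ({g | g • a = i} : Finset G),
      (if g = r (g • a) then c (g • a) else 0) = if g = r i then c i else 0 := by
    intro g hg
    rw [(Finset.mem_filter.1 hg).2]
  simp only [orbitSum, map_sum, aeval_X]
  rw [Finset.sum_congr rfl h, Finset.sum_ite_eq', if_pos (by simp [hr])]

theorem aeval_orbitVar_ne_zero [MulAction.IsPretransitive G α] (c : α → K)
    {P : MvPolynomial α K} (hP : eval c P ≠ 0) : aeval (orbitVar (G := G) K a) P ≠ 0 := by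
  obtain ⟨θ, hθ⟩ := exists_algHom_orbitSum (G := G) a c
  have h : aeval (orbitVar (G := G) K a) P =
      algebraMap (MvPolynomial G K) (FnField K G) (aeval (orbitSum K a) P) := by
    rw [← aeval_algebraMap_apply]
    rfl
  rw [h, Ne, FaithfulSMul.algebraMap_eq_zero_iff]
  intro h0
  refine hP ?_
  have := congrArg θ h0
  rwa [← AlgHom.comp_apply, comp_aeval, map_zero, funext hθ] at this

theorem orbitVar_injective [MulAction.IsPretransitive G α] :
    Function.Injective (orbitVar (G := G) K a) := by
  intro i j hij
  by_contra hne
  refine aeval_orbitVar_ne_zero (G := G) (K := K) a (fun m ↦ if m = i then 1 else 0)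
    (P := X i - X j) ?_ ?_
  · simp [Ne.symm hne]
  · simp [hij]

theorem galAction_orbitVar (g : G) (i : α) :
    galAction K G g (orbitVar K a i) = orbitVar K a (g • i) := by
  have h : ∀ j, orbitVar (G := G) K a j = ∑ h : G with h • a = j, fnVar K h := fun j ↦ by
    simp [orbitVar, orbitSum, fnVar]
  rw [h, h, map_sum]
  refine Finset.sum_equiv (Equiv.mulLeft g) (fun h ↦ ?_) (fun h _ ↦ galAction_fnVar g h)
  simp [mul_smul]

end OrbitSum

end UpperBound

section AffineRatio

open MvPolynomial IntermediateField

/-- The ratio of the differences `y_i - y_j` and `y_k - y_l`. -/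
def affineRatio {α F : Type*} [Field F] (y : α → F) (i j k l : α) : F :=
  (y i - y j) / (y k - y l)

theorem affineRatio_mem {α F : Type*} [Field F] {σ : Type*} [SetLike σ F] [SubfieldClass σ F]
    {E : σ} {y : α → F} {a b : α} (hab : y b ≠ y a) (hE : ∀ i, affineRatio y i a b a ∈ E)
    (i j k l : α) : affineRatio y i j k l ∈ E := by
  have h : affineRatio y i j k l = (affineRatio y i a b a - affineRatio y j a b a) /
      (affineRatio y k a b a - affineRatio y l a b a) := by
    simp only [affineRatio, ← sub_div, sub_sub_sub_cancel_right]
    rw [div_div_div_cancel_right₀ (sub_ne_zero.2 hab)]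
  rw [h]
  exact div_mem (sub_mem (hE i) (hE j)) (sub_mem (hE k) (hE l))

variable {K : Type*} [Field K] {G : Type*} [Group G] [Fintype G] {α : Type*} [DecidableEq α]
  [MulAction G α]

theorem galAction_affineRatio (g : G) (a i j k l : α) :
    galAction K G g (affineRatio (orbitVar K a) i j k l) =
      affineRatio (orbitVar K a) (g • i) (g • j) (g • k) (g • l) := by
  simp only [affineRatio, map_div₀, map_sub, galAction_orbitVar]

variable [MulAction.IsPretransitive G α]

theorem exists_galAction_affineRatio_ne [Fintype α] [FaithfulSMul G α]
    (hα : 3 ≤ Fintype.card α) (a : α) {g : G} (hg : g ≠ 1) :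
    ∃ i j k l, galAction K G g (affineRatio (orbitVar K a) i j k l) ≠
      affineRatio (orbitVar K a) i j k l := by
  obtain ⟨i, hi⟩ : ∃ i : α, g • i ≠ i := by
    by_contra! h
    exact hg (FaithfulSMul.eq_of_smul_eq_smul (α := α) fun i ↦ by rw [h, one_smul])
  obtain ⟨k, hki, hkg⟩ : ∃ k, k ≠ i ∧ k ≠ g • i := by
    by_contra! h
    have := (Finset.card_le_card (s := Finset.univ) (t := {i, g • i}) fun k _ ↦ by
      have := h k; simp; tauto).trans Finset.card_le_two
    rw [Finset.card_univ] at this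
    omega
  refine ⟨i, g • i, i, k, ?_⟩
  rw [galAction_affineRatio]
  have hinj := orbitVar_injective (G := G) (K := K) a
  have h1 : orbitVar (G := G) K a (g • i) - orbitVar K a (g • k) ≠ 0 :=
    sub_ne_zero.2 (hinj.ne ((MulAction.injective g).ne hki.symm))
  have h2 : orbitVar (G := G) K a i - orbitVar K a k ≠ 0 := sub_ne_zero.2 (hinj.ne hki.symm)
  rw [affineRatio, affineRatio, Ne, div_eq_div_iff h1 h2, ← sub_eq_zero]
  have key : ∀ c : α → K, (c (g • i) - c (g • g • i)) * (c i - c k) -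
      (c i - c (g • i)) * (c (g • i) - c (g • k)) ≠ 0 →
      ¬ (orbitVar (G := G) K a (g • i) - orbitVar K a (g • g • i)) *
        (orbitVar K a i - orbitVar K a k) - (orbitVar K a i - orbitVar K a (g • i)) *
        (orbitVar K a (g • i) - orbitVar K a (g • k)) = 0 := by
    intro c hc
    have h := aeval_orbitVar_ne_zero (G := G) a c (P := (X (g • i) - X (g • g • i)) *
      (X i - X k) - (X i - X (g • i)) * (X (g • i) - X (g • k))) (by simpa using hc)
    simpa only [map_sub, map_mul, aeval_X] using h
  by_cases hgg : g • g • i = i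
  · refine key (fun m ↦ if m = i then 1 else 0) ?_
    have hgk : g • k ≠ i := fun h ↦ hkg (MulAction.injective g (h.trans hgg.symm))
    simp [hi, hki, hgg, hgk]
  · refine key (fun m ↦ if m = i ∨ m = g • i then 0 else 1) ?_
    have hgi : g • g • i ≠ g • i := (MulAction.injective g).ne hi
    simp [hki, hkg, hgg, hgi]

theorem edK_le_of_affineRatio [Fintype α] [FaithfulSMul G α] (hα : 3 ≤ Fintype.card α) {d : ℕ}
    (a b : α) (hab : a ≠ b) (s : Finset α) (hs : s.card ≤ d)
    (hcover : ∀ i, i = a ∨ i = b ∨ i ∈ s) : edK K G ≤ d := by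
  classical
  set y : α → FnField K G := orbitVar K a with hy
  have hinj : Function.Injective y := orbitVar_injective (G := G) (K := K) a
  refine edK_le_of_subset_adjoin
    (S := {x | ∃ i j k l, affineRatio y i j k l = x})
    (T := s.image fun i ↦ affineRatio y i a b a) ?_ ?_ ?_ ?_
  · rintro g _ ⟨i, j, k, l, rfl⟩
    exact ⟨_, _, _, _, (galAction_affineRatio g a i j k l).symm⟩
  · intro g hg
    obtain ⟨i, j, k, l, h⟩ := exists_galAction_affineRatio_ne (K := K) hα a hg
    exact ⟨_, ⟨i, j, k, l, rfl⟩, h⟩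
  · rintro _ ⟨i, j, k, l, rfl⟩
    have hba : y b ≠ y a := hinj.ne hab.symm
    refine affineRatio_mem (a := a) (b := b) hba (fun i ↦ ?_) i j k l
    rcases hcover i with rfl | rfl | hi
    · simp [affineRatio]
    · simp [affineRatio, sub_ne_zero.2 hba]
    · exact subset_adjoin _ _ (Finset.mem_coe.2 (Finset.mem_image_of_mem _ hi))
  · refine Cardinal.mk_coe_finset.trans_le ?_
    exact_mod_cast Finset.card_image_le.trans hs

end AffineRatio

section CrossRatio

open MvPolynomial IntermediateField

/-- The cross-ratio of `y_i`, `y_k`, `y_j`, `y_l`. -/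
def crossRatio {α F : Type*} [Field F] (y : α → F) (i j k l : α) : F :=
  (y i - y j) * (y k - y l) / ((y i - y l) * (y k - y j))

theorem crossRatio_mem {α F : Type*} [Field F] {σ : Type*} [SetLike σ F] [SubfieldClass σ F]
    {E : σ} {y p q L : α → F} {μ : F} (hμ : μ ≠ 0) (hL : ∀ i, L i ≠ 0)
    (hp : ∀ i, p i ∈ E) (hq : ∀ i, q i ∈ E)
    (h : ∀ i j, y i - y j = L i * L j * μ * (p i * q j - p j * q i)) (i j k l : α) :
    crossRatio y i j k l ∈ E := by
  have hd : ∀ i j, p i * q j - p j * q i ∈ E := fun i j ↦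
    sub_mem (mul_mem (hp i) (hq j)) (mul_mem (hp j) (hq i))
  generalize hdef : (fun i j ↦ p i * q j - p j * q i) = d at *
  have hd' : ∀ i j, p i * q j - p j * q i = d i j := fun i j ↦ by rw [← hdef]
  simp only [hd'] at h hd
  have hc : L i * L j * (L k * L l) * μ ^ 2 ≠ 0 := by simp [hμ, hL]
  have h' : crossRatio y i j k l = d i j * d k l / (d i l * d k j) := by
    rw [crossRatio, ← mul_div_mul_left (d i j * d k l) (d i l * d k j) hc, h, h, h, h]
    congr 1 <;> ring
  rw [h']
  exact div_mem (mul_mem (hd _ _) (hd _ _)) (mul_mem (hd _ _) (hd _ _))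

theorem crossRatio_mem_adjoin {K F : Type*} [Field K] [Field F] [Algebra K F] {y : Fin 5 → F}
    (hy : Function.Injective y) (i j k l : Fin 5) :
    crossRatio y i j k l ∈ adjoin K {crossRatio y 1 2 3 0, crossRatio y 1 2 4 0} := by
  have h01 : y 0 - y 1 ≠ 0 := sub_ne_zero.2 (hy.ne (by decide))
  have h02 : y 0 - y 2 ≠ 0 := sub_ne_zero.2 (hy.ne (by decide))
  have h12 : y 1 - y 2 ≠ 0 := sub_ne_zero.2 (hy.ne (by decide))
  have h32 : y 3 - y 2 ≠ 0 := sub_ne_zero.2 (hy.ne (by decide))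
  have h42 : y 4 - y 2 ≠ 0 := sub_ne_zero.2 (hy.ne (by decide))
  have h10 : y 1 - y 0 ≠ 0 := sub_ne_zero.2 (hy.ne (by decide))
  set E := adjoin K {crossRatio y 1 2 3 0, crossRatio y 1 2 4 0} with hE
  have hu : crossRatio y 1 2 3 0 ∈ E := subset_adjoin _ _ (by simp)
  have hv : crossRatio y 1 2 4 0 ∈ E := subset_adjoin _ _ (by simp)
  have hμ : (y 1 - y 0) / ((y 1 - y 2) * (y 0 - y 2)) ≠ 0 :=
    div_ne_zero h10 (mul_ne_zero h12 h02)
  refine crossRatio_mem (p := ![0, 1, 1, crossRatio y 1 2 3 0, crossRatio y 1 2 4 0])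
    (q := ![1, 1, 0, 1, 1])
    (L := ![y 0 - y 2, y 1 - y 2, -((y 1 - y 2) * (y 0 - y 2) / (y 1 - y 0)), y 3 - y 2, y 4 - y 2])
    hμ ?_ ?_ ?_ ?_ i j k l
  · intro i
    fin_cases i <;> simp [*, -hE]
  · intro i
    fin_cases i <;> simp [*, -hE]
  · intro i
    fin_cases i <;> simp
  · intro i j
    fin_cases i <;> fin_cases j <;> simp [crossRatio] <;> field_simp <;> ring

variable {K : Type*} [Field K] {G : Type*} [Group G] [Fintype G]

theorem galAction_crossRatio {α : Type*} [DecidableEq α] [MulAction G α] (g : G)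
    (a i j k l : α) : galAction K G g (crossRatio (orbitVar K a) i j k l) =
      crossRatio (orbitVar K a) (g • i) (g • j) (g • k) (g • l) := by
  simp only [crossRatio, map_div₀, map_mul, map_sub, galAction_orbitVar]

theorem edK_le_two_of_crossRatio [IsSimpleGroup G] [MulAction G (Fin 5)]
    [MulAction.IsPretransitive G (Fin 5)]
    (hG : ∃ g : G, g • (0 : Fin 5) = 0 ∧ g • (1 : Fin 5) = 1 ∧ g • (2 : Fin 5) = 3 ∧
      g • (3 : Fin 5) = 4) : edK K G ≤ 2 := by
  set y : Fin 5 → FnField K G := orbitVar K 0 with hy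
  have hinj : Function.Injective y := orbitVar_injective (G := G) (K := K) 0
  have hS : ∀ g, ∀ s ∈ {x | ∃ i j k l, crossRatio y i j k l = x},
      galAction K G g s ∈ {x | ∃ i j k l, crossRatio y i j k l = x} := by
    rintro g _ ⟨i, j, k, l, rfl⟩
    exact ⟨_, _, _, _, (galAction_crossRatio g 0 i j k l).symm⟩
  refine edK_le_of_subset_adjoin
    (T := {crossRatio y 1 2 3 0, crossRatio y 1 2 4 0}) hS
    (exists_galAction_ne_of_isSimpleGroup hS ?_) ?_ ?_
  · obtain ⟨g, h0, h1, h2, h3⟩ := hG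
    refine ⟨g, _, ⟨0, 1, 2, 3, rfl⟩, ?_⟩
    rw [galAction_crossRatio, h0, h1, h2, h3, ← hy]
    have hne : ∀ i j, i ≠ j → y i - y j ≠ 0 := fun i j h ↦ sub_ne_zero.2 (hinj.ne h)
    have h := aeval_orbitVar_ne_zero (G := G) (0 : Fin 5) (![1, 1, 0, 0, 1] : Fin 5 → K)
      (P := (X 3 - X 4) * (X 0 - X 3) * (X 2 - X 1) - (X 2 - X 3) * (X 0 - X 4) * (X 3 - X 1))
      (by simp)
    simp only [map_sub, map_mul, aeval_X] at h
    intro heq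
    refine h ?_
    rw [crossRatio, crossRatio, div_eq_div_iff (by simp [hne]) (by simp [hne])] at heq
    have h01 := hne 0 1 (by decide)
    refine mul_left_cancel₀ h01 ?_
    linear_combination heq
  · rintro _ ⟨i, j, k, l, rfl⟩
    exact crossRatio_mem_adjoin hinj i j k l
  · refine (Cardinal.mk_insert_le).trans ?_
    rw [Cardinal.mk_singleton]
    norm_num

end CrossRatio

/-- If `char K ≠ 2`, then `ed_K(A₃) = 1`, `ed_K(A₄) = ed_K(A₅) = 2`,
`ed_K(A_{n+4}) ≥ ed_K(Aₙ) + 2` for every `n ≥ 4`, and `ed_K(Aₙ) ≥ 2⌊n/4⌋` for every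
`n ≥ 3`. -/
theorem edK_alternatingGroup_lower (K : Type*) [Field K] (hchar : ringChar K ≠ 2) :
    edK K ↥(alternatingGroup (Fin 3)) = 1 ∧
    edK K ↥(alternatingGroup (Fin 4)) = 2 ∧
    edK K ↥(alternatingGroup (Fin 5)) = 2 ∧
    (∀ n : ℕ, 4 ≤ n →
      edK K ↥(alternatingGroup (Fin n)) + 2 ≤ edK K ↥(alternatingGroup (Fin (n + 4)))) ∧
    (∀ n : ℕ, 3 ≤ n → 2 * (n / 4) ≤ edK K ↥(alternatingGroup (Fin n))) := by
  have h2 : (2 : K) ≠ 0 := Ring.two_ne_zero hchar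
  have htrans (n : ℕ) : MulAction.IsPretransitive (alternatingGroup (Fin (n + 3))) (Fin (n + 3)) :=
    alternatingGroup.isPretransitive_of_three_le_card _ (by simp)
  have hstep : ∀ n : ℕ, 4 ≤ n →
      edK K ↥(alternatingGroup (Fin n)) + 2 ≤ edK K ↥(alternatingGroup (Fin (n + 4))) :=
    fun n hn ↦ edK_alternatingGroup_add_two_le h2 hn
  refine ⟨le_antisymm ?_ ?_, le_antisymm ?_ ?_, le_antisymm ?_ ?_, hstep, ?_⟩
  · have := htrans 0
    exact edK_le_of_affineRatio (by simp) (0 : Fin 3) 1 (by decide) {2} (by simp) (by decide)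
  · have : Nontrivial (alternatingGroup (Fin 3)) := alternatingGroup.nontrivial_of_three_le_card
      (by simp)
    exact one_le_edK
  · have := htrans 1
    exact edK_le_of_affineRatio (by simp) (0 : Fin 4) 1 (by decide) {2, 3} (by simp) (by decide)
  · exact two_le_edK_alternatingGroup h2 0
  · have := htrans 2
    have : IsSimpleGroup (alternatingGroup (Fin 5)) := alternatingGroup.isSimpleGroup (by simp)
    exact edK_le_two_of_crossRatio (by decide +kernel)
  · exact two_le_edK_alternatingGroup h2 1
  · intro n hn
    induction n using Nat.strong_induction_on with
    | _ n ih =>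
      rcases hn.eq_or_lt with rfl | hn
      · simp
      rcases lt_or_ge n 8 with h8 | h8
      · have h := two_le_edK_alternatingGroup h2 (n - 4)
        rw [Nat.sub_add_cancel hn] at h
        omega
      · have h := hstep (n - 4) (by omega)
        rw [Nat.sub_add_cancel hn] at h
        have := ih (n - 4) (by omega) (by omega)
        omega
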